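/- For every e ∈ (0,1) and ℓ ∈ ℝ, the eccentric anomaly satisfies ∂u/∂e (e,ℓ) = sin(u(e,ℓ))/(1 − e·cos(u(e,ℓ))), the derivative being taken at fixed mean anomaly ℓ. -/

import Mathlib

open Filter Topology in
/-- For every `e ∈ (0,1)` and `ℓ ∈ ℝ`, the eccentric anomaly
(the unique solution `U e ℓ` of Kepler's equation) satisfies
`∂u/∂e (e,ℓ) = sin(u(e,ℓ))/(1 − e·cos(u(e,ℓ)))`, the derivative being taken at
fixed mean anomaly `ℓ`. -/
theorem stmt_1 (U : ℝ → ℝ → ℝ)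
    (hU : ∀ e ∈ Set.Ico (0:ℝ) 1, ∀ ℓ : ℝ, U e ℓ - e * Real.sin (U e ℓ) = ℓ) :
    ∀ e ∈ Set.Ioo (0:ℝ) 1, ∀ ℓ : ℝ,
      HasDerivAt (fun e' : ℝ => U e' ℓ)
        (Real.sin (U e ℓ) / (1 - e * Real.cos (U e ℓ))) e := by
  intro e he ℓ
  have h0 := he.1
  have h1 := he.2
  have hu := hU e ⟨h0.le, h1⟩ ℓ
  have hev : ∀ᶠ x in 𝓝 e, x ∈ Set.Ioo (0:ℝ) 1 := Ioo_mem_nhds h0 h1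
  have hlip : ∀ a b : ℝ, |Real.sin a - Real.sin b| ≤ |a - b| := by
    intro a b
    have h := Convex.norm_image_sub_le_of_norm_deriv_le (f := Real.sin) (C := 1) (s := Set.univ)
      (x := b) (y := a) (fun x _ => Real.differentiableAt_sin)
      (fun x _ => by simpa using Real.abs_cos_le_one x) convex_univ trivial trivial
    simpa using h
  have hcont : Tendsto (fun x => U x ℓ) (𝓝 e) (𝓝 (U e ℓ)) := by
    rw [tendsto_iff_dist_tendsto_zero]
    have hz : Tendsto (fun x : ℝ => |x - e| / (1 - e)) (𝓝 e) (𝓝 0) := by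
      have : Continuous (fun x : ℝ => |x - e| / (1 - e)) := by fun_prop
      simpa using this.tendsto e
    refine squeeze_zero' (Eventually.of_forall fun _ => dist_nonneg) ?_ hz
    filter_upwards [hev] with x hx
    have hv := hU x ⟨hx.1.le, hx.2⟩ ℓ
    rw [Real.dist_eq, le_div_iff₀ (by linarith)]
    have key : U x ℓ - U e ℓ = e * (Real.sin (U x ℓ) - Real.sin (U e ℓ))
        + (x - e) * Real.sin (U x ℓ) := by linarith
    have h2 := abs_add_le (e * (Real.sin (U x ℓ) - Real.sin (U e ℓ)))
      ((x - e) * Real.sin (U x ℓ))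
    rw [← key, abs_mul, abs_mul, abs_of_pos h0] at h2
    have h3 := mul_le_mul_of_nonneg_left (hlip (U x ℓ) (U e ℓ)) h0.le
    have h4 := mul_le_mul_of_nonneg_left (Real.abs_sin_le_one (U x ℓ)) (abs_nonneg (x - e))
    linarith
  have hg : Tendsto (fun x => 1 - e * dslope Real.sin (U e ℓ) (U x ℓ)) (𝓝 e)
      (𝓝 (1 - e * Real.cos (U e ℓ))) := by
    have h := (continuousAt_dslope_same.2 (Real.differentiableAt_sin (x := U e ℓ))).tendsto
    rw [dslope_same, Real.deriv_sin] at h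
    exact ((h.comp hcont).const_mul e).const_sub 1
  have hpos : 0 < 1 - e * Real.cos (U e ℓ) := by
    nlinarith [Real.cos_le_one (U e ℓ)]
  have hs : Tendsto (fun x => Real.sin (U x ℓ)) (𝓝 e) (𝓝 (Real.sin (U e ℓ))) :=
    (Real.continuous_sin.tendsto _).comp hcont
  rw [hasDerivAt_iff_tendsto_slope]
  refine Tendsto.congr' ?_ ((hs.div hg hpos.ne').mono_left nhdsWithin_le_nhds)
  filter_upwards [nhdsWithin_le_nhds hev, nhdsWithin_le_nhds (hg.eventually (lt_mem_nhds hpos)),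
    self_mem_nhdsWithin] with x hx hgx hne
  have hv := hU x ⟨hx.1.le, hx.2⟩ ℓ
  have hd := sub_smul_dslope Real.sin (U e ℓ) (U x ℓ)
  rw [smul_eq_mul] at hd
  have hne' : x - e ≠ 0 := sub_ne_zero.2 hne
  rw [slope_def_field, Pi.div_apply, div_eq_div_iff hgx.ne' hne']
  linear_combination -hv + hu + e * hd
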